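/- Almost surely, Π̂(n) ~ n/log n as n → ∞; that is, for ℙ-almost every realization α of the Hawkins random sieve, Π̂(n; α)·(log n)/n → 1. -/

import Mathlib

open MeasureTheory Filter Finset Asymptotics
open scoped Classical

/-- `y_m(α) = ∏_{j ∈ α, j < m} (1 - 1/j)` (empty product = 1). -/
noncomputable def hawkinsY (A : Set ℕ) (m : ℕ) : ℝ :=
  ∏ j ∈ Finset.range m, if j ∈ A then 1 - 1 / (j : ℝ) else 1

/-- The σ-algebra generated by the events `{j ∈ α}` for `2 ≤ j < m`. -/
def sieveSigma {Ω : Type*} (α : Ω → Set ℕ) (m : ℕ) : MeasurableSpace Ω :=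
  MeasurableSpace.generateFrom {s | ∃ j : ℕ, 2 ≤ j ∧ j < m ∧ s = {ω | j ∈ α ω}}

/-- Wunderlich's model of the Hawkins random sieve: a probability space `(Ω, μ)` with a
random subset `α` of `{2,3,4,…}` such that `μ(2 ∈ α) = 1` and, for every `m ≥ 2`, the
conditional probability of `{m ∈ α}` given the σ-algebra generated by the events
`{j ∈ α}`, `2 ≤ j < m`, equals `y_m(α)`. -/
structure IsHawkinsSieve {Ω : Type*} [MeasurableSpace Ω] (μ : Measure Ω)
    (α : Ω → Set ℕ) : Prop where
  isProb : IsProbabilityMeasure μ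
  meas : ∀ n : ℕ, MeasurableSet {ω | n ∈ α ω}
  mem_ge_two : ∀ ω, ∀ n ∈ α ω, 2 ≤ n
  two_mem : μ {ω | 2 ∈ α ω} = 1
  condExp_mem : ∀ m : ℕ, 2 ≤ m →
    μ[Set.indicator {ω | m ∈ α ω} (fun _ => (1 : ℝ)) | sieveSigma α m]
      =ᵐ[μ] fun ω => hawkinsY (α ω) m

/-- `M_k = 1 + ∑_{j=1}^{k-2} 1/j` (so `M_2 = 1`). -/
noncomputable def Mharm (k : ℕ) : ℝ := 1 + ∑ j ∈ Finset.Icc 1 (k - 2), 1 / (j : ℝ)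

/-- `Π̂(x; α) = Σ_{m ≤ x, m ∈ α, m+2 ∈ α} (y_m(α) - (1/(m+1))(1 - 1/m) y_m(α)^2)⁻¹`. -/
noncomputable def piHat (A : Set ℕ) (x : ℕ) : ℝ :=
  ∑ m ∈ Finset.range (x + 1),
    if m ∈ A ∧ m + 2 ∈ A then
      (hawkinsY A m - (1 / ((m : ℝ) + 1)) * (1 - 1 / (m : ℝ)) * (hawkinsY A m) ^ 2)⁻¹
    else 0

section BoundedMeasurable

variable {Ω : Type*}

/-- `f` is bounded and strongly measurable with respect to `m`. -/
def IsBddMeas (m : MeasurableSpace Ω) (f : Ω → ℝ) : Prop :=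
  StronglyMeasurable[m] f ∧ ∃ C : ℝ, ∀ ω, |f ω| ≤ C

namespace IsBddMeas

variable {m m' : MeasurableSpace Ω} {f g : Ω → ℝ}

theorem const (c : ℝ) : IsBddMeas m (fun _ : Ω => c) :=
  ⟨stronglyMeasurable_const, |c|, fun _ => le_rfl⟩

theorem mono (hf : IsBddMeas m f) (hm : m ≤ m') : IsBddMeas m' f :=
  ⟨hf.1.mono hm, hf.2⟩

theorem add (hf : IsBddMeas m f) (hg : IsBddMeas m g) : IsBddMeas m (fun ω => f ω + g ω) := by
  obtain ⟨hf, C, hC⟩ := hf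
  obtain ⟨hg, D, hD⟩ := hg
  exact ⟨hf.add hg, C + D, fun ω => (abs_add_le _ _).trans (add_le_add (hC ω) (hD ω))⟩

theorem mul (hf : IsBddMeas m f) (hg : IsBddMeas m g) : IsBddMeas m (fun ω => f ω * g ω) := by
  obtain ⟨hf, C, hC⟩ := hf
  obtain ⟨hg, D, hD⟩ := hg
  refine ⟨hf.mul hg, C * D, fun ω => ?_⟩
  rw [abs_mul]
  exact mul_le_mul (hC ω) (hD ω) (abs_nonneg _) ((abs_nonneg _).trans (hC ω))

theorem sub (hf : IsBddMeas m f) (hg : IsBddMeas m g) : IsBddMeas m (fun ω => f ω - g ω) := by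
  have h := hf.add ((const (-1)).mul hg)
  simpa [sub_eq_add_neg] using h

theorem sq (hf : IsBddMeas m f) : IsBddMeas m (fun ω => f ω ^ 2) := by
  simpa [pow_two] using hf.mul hf

theorem sum {ι : Type*} (s : Finset ι) {F : ι → Ω → ℝ} (hF : ∀ i ∈ s, IsBddMeas m (F i)) :
    IsBddMeas m (fun ω => ∑ i ∈ s, F i ω) := by
  induction s using Finset.induction_on with
  | empty => simpa using const 0
  | insert a s ha ih =>
    simp only [Finset.sum_insert ha]
    exact (hF a (Finset.mem_insert_self _ _)).add
      (ih fun i hi => hF i (Finset.mem_insert_of_mem hi))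

theorem inv (hf : IsBddMeas m f) {c : ℝ} (hc : 0 < c) (h : ∀ ω, c ≤ f ω) :
    IsBddMeas m (fun ω => (f ω)⁻¹) := by
  refine ⟨hf.1.measurable.inv.stronglyMeasurable, c⁻¹, fun ω => ?_⟩
  rw [abs_inv]
  exact inv_anti₀ hc ((h ω).trans (le_abs_self _))

theorem integrable {m0 : MeasurableSpace Ω} {μ : Measure Ω} [IsFiniteMeasure μ]
    (hf : IsBddMeas m f) (hm : m ≤ m0) : Integrable f μ := by
  obtain ⟨hf, C, hC⟩ := hf
  exact Integrable.of_bound (hf.mono hm).aestronglyMeasurable C (ae_of_all _ hC)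

end IsBddMeas

variable {m0 : MeasurableSpace Ω} {μ : Measure Ω} [IsProbabilityMeasure μ]

theorem integral_mul_eq_zero_of_condExp_eq_zero {m : MeasurableSpace Ω} (hm : m ≤ m0)
    {f g : Ω → ℝ} (hf : IsBddMeas m f) (hg : IsBddMeas m0 g) (h : μ[g | m] =ᵐ[μ] 0) :
    ∫ ω, f ω * g ω ∂μ = 0 := by
  have h1 : μ[f * g | m] =ᵐ[μ] f * μ[g | m] :=
    condExp_mul_of_stronglyMeasurable_left hf.1 (((hf.mono hm).mul hg).integrable le_rfl)
      (hg.integrable le_rfl)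
  rw [← integral_condExp hm]
  have h2 : μ[f * g | m] =ᵐ[μ] 0 := by
    filter_upwards [h1, h] with ω h1 h2
    simp [h1, h2]
  exact (integral_congr_ae h2).trans (by simp)

/-- A series of bounded martingale differences with summable second moments converges almost
surely. -/
theorem ae_exists_tendsto_sum_of_condExp_eq_zero (ℱ : Filtration ℕ m0) {D : ℕ → Ω → ℝ}
    (hD : ∀ k, IsBddMeas (ℱ (k + 1)) (D k)) (hc : ∀ k, μ[D k | ℱ k] =ᵐ[μ] 0)
    (hs : Summable fun k => ∫ ω, D k ω ^ 2 ∂μ) :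
    ∀ᵐ ω ∂μ, ∃ l, Tendsto (fun n => ∑ k ∈ Finset.range n, D k ω) atTop (nhds l) := by
  set S : ℕ → Ω → ℝ := fun n ω => ∑ k ∈ Finset.range n, D k ω with hS
  have hSb : ∀ n, IsBddMeas (ℱ n) (S n) := fun n =>
    IsBddMeas.sum _ fun i hi => (hD i).mono (ℱ.mono (Finset.mem_range.mp hi))
  have hD0 : ∀ k, IsBddMeas m0 (D k) := fun k => (hD k).mono (ℱ.le _)
  have hS0 : ∀ k, IsBddMeas m0 (S k) := fun k => (hSb k).mono (ℱ.le _)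
  have hsucc : ∀ n, S (n + 1) = S n + D n := fun n => by
    ext ω; simp [hS, Finset.sum_range_succ]
  have hmart : Martingale S ℱ μ := by
    refine martingale_nat (fun n => (hSb n).1) (fun n => (hS0 n).integrable le_rfl) fun n => ?_
    rw [hsucc]
    have h1 := condExp_add (μ := μ) ((hS0 n).integrable le_rfl) ((hD0 n).integrable le_rfl) (ℱ n)
    have h2 := condExp_of_stronglyMeasurable (μ := μ) (ℱ.le n) (hSb n).1
      ((hS0 n).integrable le_rfl)
    filter_upwards [h1, hc n] with ω h1 h3
    rw [h1, Pi.add_apply, h3, h2]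
    simp
  have hsq : ∀ n, ∫ ω, S n ω ^ 2 ∂μ = ∑ k ∈ Finset.range n, ∫ ω, D k ω ^ 2 ∂μ := by
    intro n
    induction n with
    | zero => simp [hS]
    | succ n ih =>
      rw [Finset.sum_range_succ, ← ih]
      have h0 := integral_mul_eq_zero_of_condExp_eq_zero (ℱ.le n) (hSb n) (hD0 n) (hc n)
      have : ∀ ω, S (n + 1) ω ^ 2 = S n ω ^ 2 + D n ω ^ 2 + 2 * (S n ω * D n ω) := fun ω => by
        rw [hsucc]; simp only [Pi.add_apply]; ring
      simp_rw [this]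
      rw [integral_add (((hS0 n).sq.add (hD0 n).sq).integrable le_rfl)
        (((IsBddMeas.const 2).mul ((hS0 n).mul (hD0 n))).integrable le_rfl),
        integral_add ((hS0 n).sq.integrable le_rfl) ((hD0 n).sq.integrable le_rfl),
        integral_const_mul, h0]
      ring
  set R : ℝ := 1 + ∑' k, ∫ ω, D k ω ^ 2 ∂μ with hR
  refine hmart.submartingale.exists_ae_tendsto_of_bdd (R := R.toNNReal) fun n => ?_
  have hint : Integrable (S n) μ := (hS0 n).integrable le_rfl
  rw [eLpNorm_one_eq_lintegral_enorm, ← ofReal_integral_norm_eq_lintegral_enorm hint]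
  refine ENNReal.ofReal_le_ofReal ?_
  calc ∫ ω, ‖S n ω‖ ∂μ ≤ ∫ ω, 1 + S n ω ^ 2 ∂μ := by
        refine integral_mono hint.norm
          (((IsBddMeas.const 1).add (hS0 n).sq).integrable le_rfl) fun ω => ?_
        simp only [Real.norm_eq_abs]
        nlinarith [sq_abs (S n ω), sq_nonneg (|S n ω| - 1)]
    _ = 1 + ∑ k ∈ Finset.range n, ∫ ω, D k ω ^ 2 ∂μ := by
        rw [integral_add ((IsBddMeas.const 1).integrable (le_refl m0))
          ((hS0 n).sq.integrable le_rfl), hsq]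
        simp
    _ ≤ R := by
        have := hs.sum_le_tsum (Finset.range n)
          fun k _ => integral_nonneg fun ω => sq_nonneg (D k ω)
        linarith

/-- The filtration that only changes at indices congruent to `r` modulo `3`. -/
def stepThreeFiltration (ℱ : Filtration ℕ m0) (r : ℕ) : Filtration ℕ m0 where
  seq k := ℱ (3 * ((k + 2 - r) / 3) + r)
  mono' a b hab := ℱ.mono (by
    have : (a + 2 - r) / 3 ≤ (b + 2 - r) / 3 := Nat.div_le_div_right (by omega)
    omega)
  le' _ := ℱ.le _

/-- Variant of `ae_exists_tendsto_sum_of_condExp_eq_zero` for differences that are measurable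
three steps later. -/
theorem ae_exists_tendsto_sum_of_condExp_eq_zero_three (ℱ : Filtration ℕ m0) {D : ℕ → Ω → ℝ}
    (hD : ∀ k, IsBddMeas (ℱ (k + 3)) (D k)) (hc : ∀ k, μ[D k | ℱ k] =ᵐ[μ] 0)
    (hs : Summable fun k => ∫ ω, D k ω ^ 2 ∂μ) :
    ∀ᵐ ω ∂μ, ∃ l, Tendsto (fun n => ∑ k ∈ Finset.range n, D k ω) atTop (nhds l) := by
  have key : ∀ r, r < 3 → ∀ᵐ ω ∂μ, ∃ l, Tendsto
      (fun n => ∑ k ∈ Finset.range n, if k % 3 = r then D k ω else 0) atTop (nhds l) := by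
    intro r hr
    refine ae_exists_tendsto_sum_of_condExp_eq_zero (μ := μ) (stepThreeFiltration ℱ r)
      (D := fun k ω => if k % 3 = r then D k ω else 0) (fun k => ?_) (fun k => ?_) ?_
    · by_cases hk : k % 3 = r
      · simp only [hk, if_true]
        have : 3 * ((k + 1 + 2 - r) / 3) + r = k + 3 := by omega
        simpa only [stepThreeFiltration, this] using hD k
      · simp only [hk, if_false]
        exact IsBddMeas.const 0
    · by_cases hk : k % 3 = r
      · simp only [hk, if_true]
        have : 3 * ((k + 2 - r) / 3) + r = k := by omega
        simpa only [stepThreeFiltration, this] using hc k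
      · simp only [hk, if_false]
        exact (condExp_zero (μ := μ)).eventuallyEq
    · refine hs.of_nonneg_of_le (fun k => integral_nonneg fun ω => sq_nonneg _) fun k => ?_
      by_cases hk : k % 3 = r
      · simp [hk]
      · simpa [hk] using integral_nonneg fun ω => sq_nonneg (D k ω)
  filter_upwards [key 0 (by norm_num), key 1 (by norm_num), key 2 (by norm_num)]
    with ω ⟨a, ha⟩ ⟨b, hb⟩ ⟨c, hc⟩
  refine ⟨a + b + c, ((ha.add hb).add hc).congr fun n => ?_⟩
  rw [← Finset.sum_add_distrib, ← Finset.sum_add_distrib]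
  refine Finset.sum_congr rfl fun k _ => ?_
  have : k % 3 = 0 ∨ k % 3 = 1 ∨ k % 3 = 2 := by omega
  rcases this with h | h | h <;> simp [h]

end BoundedMeasurable

section HawkinsDeterministic

variable {A : Set ℕ}

theorem hawkinsY_succ (A : Set ℕ) (m : ℕ) :
    hawkinsY A (m + 1) = hawkinsY A m * if m ∈ A then 1 - 1 / (m : ℝ) else 1 :=
  Finset.prod_range_succ _ _

theorem hawkinsY_two (hA : ∀ n ∈ A, 2 ≤ n) : hawkinsY A 2 = 1 := by
  refine Finset.prod_eq_one fun j hj => if_neg fun h => ?_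
  have := hA j h
  have := Finset.mem_range.mp hj
  omega

theorem half_pow_le_hawkinsY (hA : ∀ n ∈ A, 2 ≤ n) (m : ℕ) : (1 / 2 : ℝ) ^ m ≤ hawkinsY A m := by
  induction m with
  | zero => simp [hawkinsY]
  | succ m ih =>
    rw [hawkinsY_succ, pow_succ]
    refine mul_le_mul ih ?_ (by norm_num) ((by positivity : (0 : ℝ) ≤ (1 / 2) ^ m).trans ih)
    split_ifs with h
    · have : (2 : ℝ) ≤ m := by exact_mod_cast hA m h
      have : 1 / (m : ℝ) ≤ 1 / 2 := one_div_le_one_div_of_le (by norm_num) this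
      linarith
    · norm_num

theorem hawkinsY_pos (hA : ∀ n ∈ A, 2 ≤ n) (m : ℕ) : 0 < hawkinsY A m :=
  lt_of_lt_of_le (by positivity) (half_pow_le_hawkinsY hA m)

theorem hawkinsY_le_one (hA : ∀ n ∈ A, 2 ≤ n) (m : ℕ) : hawkinsY A m ≤ 1 := by
  induction m with
  | zero => simp [hawkinsY]
  | succ m ih =>
    rw [hawkinsY_succ]
    refine (mul_le_of_le_one_right (hawkinsY_pos hA m).le ?_).trans ih
    split_ifs
    · have : 0 ≤ 1 / (m : ℝ) := by positivity
      linarith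
    · exact le_rfl

/-- The reciprocal of the weight given to a twin pair `(m, m + 2)` in `piHat`. -/
noncomputable def twinDensity (A : Set ℕ) (m : ℕ) : ℝ :=
  hawkinsY A m - (1 / ((m : ℝ) + 1)) * (1 - 1 / (m : ℝ)) * (hawkinsY A m) ^ 2

theorem two_thirds_mul_le_twinDensity (hA : ∀ n ∈ A, 2 ≤ n) {m : ℕ} (hm : 2 ≤ m) :
    2 / 3 * hawkinsY A m ≤ twinDensity A m := by
  have h0 := hawkinsY_pos hA m
  have h1 := hawkinsY_le_one hA m
  have hm' : (2 : ℝ) ≤ m := by exact_mod_cast hm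
  have h2 : 1 / ((m : ℝ) + 1) ≤ 1 / 3 := one_div_le_one_div_of_le (by norm_num) (by linarith)
  have h3 : 0 ≤ 1 / (m : ℝ) := by positivity
  have h5 : 1 / (m : ℝ) ≤ 1 / 2 := one_div_le_one_div_of_le (by norm_num) hm'
  have h4 : (1 / ((m : ℝ) + 1)) * (1 - 1 / (m : ℝ)) ≤ 1 / 3 * 1 :=
    mul_le_mul h2 (by linarith) (by linarith) (by norm_num)
  have h6 : (hawkinsY A m) ^ 2 ≤ hawkinsY A m := by nlinarith
  have h7 : (1 / ((m : ℝ) + 1)) * (1 - 1 / (m : ℝ)) * (hawkinsY A m) ^ 2 ≤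
      1 / 3 * 1 * hawkinsY A m := mul_le_mul h4 h6 (sq_nonneg _) (by norm_num)
  rw [twinDensity]
  linarith

theorem twinDensity_pos (hA : ∀ n ∈ A, 2 ≤ n) {m : ℕ} (hm : 2 ≤ m) : 0 < twinDensity A m :=
  lt_of_lt_of_le (mul_pos (by norm_num) (hawkinsY_pos hA m)) (two_thirds_mul_le_twinDensity hA hm)

/-- The `m`-th summand of `piHat`. -/
noncomputable def twinTerm (A : Set ℕ) (m : ℕ) : ℝ :=
  if m ∈ A ∧ m + 2 ∈ A then (twinDensity A m)⁻¹ else 0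

theorem piHat_eq_sum_twinTerm (A : Set ℕ) (x : ℕ) :
    piHat A x = ∑ m ∈ Finset.range (x + 1), twinTerm A m := rfl

end HawkinsDeterministic

section HawkinsConditional

variable {Ω : Type*}

/-- The indicator of the event `m ∈ α`. -/
noncomputable def memInd (α : Ω → Set ℕ) (m : ℕ) (ω : Ω) : ℝ :=
  Set.indicator {ω | m ∈ α ω} (fun _ => (1 : ℝ)) ω

theorem memInd_sq (α : Ω → Set ℕ) (m : ℕ) (ω : Ω) : memInd α m ω ^ 2 = memInd α m ω := by
  by_cases h : m ∈ α ω <;> simp [memInd, h]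

theorem hawkinsY_succ_eq_memInd (α : Ω → Set ℕ) (m : ℕ) (ω : Ω) :
    hawkinsY (α ω) (m + 1) = hawkinsY (α ω) m * (1 - memInd α m ω * (1 / (m : ℝ))) := by
  rw [hawkinsY_succ]
  by_cases h : m ∈ α ω <;> simp [memInd, h]

theorem twinTerm_eq_memInd (α : Ω → Set ℕ) (m : ℕ) (ω : Ω) :
    twinTerm (α ω) m = memInd α m ω * memInd α (m + 2) ω * (twinDensity (α ω) m)⁻¹ := by
  by_cases h : m ∈ α ω <;> by_cases h' : m + 2 ∈ α ω <;> simp [memInd, twinTerm, h, h']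

theorem sieveSigma_mono (α : Ω → Set ℕ) : Monotone (sieveSigma α) := fun _ _ hab =>
  MeasurableSpace.generateFrom_mono fun _ ⟨j, h2, hj, hs⟩ => ⟨j, h2, hj.trans_le hab, hs⟩

namespace IsHawkinsSieve

variable {m0 : MeasurableSpace Ω} {μ : Measure Ω} {α : Ω → Set ℕ}

theorem sieveSigma_le (h : IsHawkinsSieve μ α) (m : ℕ) : sieveSigma α m ≤ m0 :=
  MeasurableSpace.generateFrom_le fun _ ⟨j, _, _, hs⟩ => hs ▸ h.meas j

/-- The filtration of the sieve, starting with the information before the decision on `2`. -/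
def filtration (h : IsHawkinsSieve μ α) : Filtration ℕ m0 where
  seq k := sieveSigma α (k + 2)
  mono' _ _ hab := sieveSigma_mono α (Nat.add_le_add_right hab 2)
  le' _ := h.sieveSigma_le _

theorem isBddMeas_memInd (h : IsHawkinsSieve μ α) (m : ℕ) :
    IsBddMeas (sieveSigma α (m + 1)) (memInd α m) := by
  have hms : MeasurableSet[sieveSigma α (m + 1)] {ω | m ∈ α ω} := by
    by_cases hm : 2 ≤ m
    · exact MeasurableSpace.measurableSet_generateFrom ⟨m, hm, Nat.lt_succ_self m, rfl⟩
    · have : {ω | m ∈ α ω} = ∅ := by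
        ext ω
        simpa using fun hmem => hm (h.mem_ge_two ω m hmem)
      rw [this]
      exact @MeasurableSet.empty Ω (sieveSigma α (m + 1))
  refine ⟨stronglyMeasurable_const.indicator hms, 1, fun ω => ?_⟩
  by_cases hω : m ∈ α ω <;> simp [memInd, hω]

theorem isBddMeas_hawkinsY (h : IsHawkinsSieve μ α) (m : ℕ) :
    IsBddMeas (sieveSigma α m) (fun ω => hawkinsY (α ω) m) := by
  induction m with
  | zero => simpa [hawkinsY] using IsBddMeas.const 1
  | succ m ih =>
    simp_rw [hawkinsY_succ_eq_memInd]
    exact (ih.mono (sieveSigma_mono α (Nat.le_succ m))).mul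
      ((IsBddMeas.const 1).sub ((h.isBddMeas_memInd m).mul (IsBddMeas.const _)))

theorem isBddMeas_hawkinsY_inv (h : IsHawkinsSieve μ α) (m : ℕ) :
    IsBddMeas (sieveSigma α m) (fun ω => (hawkinsY (α ω) m)⁻¹) :=
  (h.isBddMeas_hawkinsY m).inv (by positivity) fun ω => half_pow_le_hawkinsY (h.mem_ge_two ω) m

theorem isBddMeas_twinDensity (h : IsHawkinsSieve μ α) (m : ℕ) :
    IsBddMeas (sieveSigma α m) (fun ω => twinDensity (α ω) m) :=
  (h.isBddMeas_hawkinsY m).sub ((IsBddMeas.const _).mul (h.isBddMeas_hawkinsY m).sq)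

theorem isBddMeas_twinDensity_inv (h : IsHawkinsSieve μ α) {m : ℕ} (hm : 2 ≤ m) :
    IsBddMeas (sieveSigma α m) (fun ω => (twinDensity (α ω) m)⁻¹) :=
  (h.isBddMeas_twinDensity m).inv (c := 2 / 3 * (1 / 2) ^ m) (by positivity) fun ω =>
    (mul_le_mul_of_nonneg_left (half_pow_le_hawkinsY (h.mem_ge_two ω) m) (by norm_num)).trans
      (two_thirds_mul_le_twinDensity (h.mem_ge_two ω) hm)

theorem condExp_memInd_mul_add (h : IsHawkinsSieve μ α) {m : ℕ} (hm : 2 ≤ m) {a b : Ω → ℝ}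
    (ha : IsBddMeas (sieveSigma α m) a) (hb : IsBddMeas (sieveSigma α m) b) :
    μ[fun ω => memInd α m ω * a ω + b ω | sieveSigma α m] =ᵐ[μ]
      fun ω => hawkinsY (α ω) m * a ω + b ω := by
  have := h.isProb
  have hle := h.sieveSigma_le m
  have hI := (h.isBddMeas_memInd m).mono (h.sieveSigma_le (m + 1))
  have h1 := condExp_add (μ := μ) ((hI.mul (ha.mono hle)).integrable le_rfl)
    (hb.integrable hle) (sieveSigma α m)
  have h2 : μ[memInd α m * a | sieveSigma α m] =ᵐ[μ] μ[memInd α m | sieveSigma α m] * a :=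
    condExp_mul_of_stronglyMeasurable_right ha.1 ((hI.mul (ha.mono hle)).integrable le_rfl)
      (hI.integrable le_rfl)
  have h3 := condExp_of_stronglyMeasurable (μ := μ) hle hb.1 (hb.integrable hle)
  have h4 : μ[memInd α m | sieveSigma α m] =ᵐ[μ] fun ω => hawkinsY (α ω) m := h.condExp_mem m hm
  refine h1.trans ?_
  filter_upwards [h2, h4] with ω h2 h4
  rw [Pi.add_apply, h3]
  refine congrArg (· + b ω) (h2.trans ?_)
  rw [Pi.mul_apply, h4]

theorem condExp_of_condExp_succ (h : IsHawkinsSieve μ α) {m : ℕ} (hm : 2 ≤ m) {f a b : Ω → ℝ}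
    (ha : IsBddMeas (sieveSigma α m) a) (hb : IsBddMeas (sieveSigma α m) b)
    (hf : μ[f | sieveSigma α (m + 1)] =ᵐ[μ] fun ω => memInd α m ω * a ω + b ω) :
    μ[f | sieveSigma α m] =ᵐ[μ] fun ω => hawkinsY (α ω) m * a ω + b ω := by
  have := h.isProb
  exact (condExp_condExp_of_le (sieveSigma_mono α (Nat.le_succ m))
    (h.sieveSigma_le (m + 1))).symm.trans
    ((condExp_congr_ae hf).trans (h.condExp_memInd_mul_add hm ha hb))

theorem integral_memInd_mul_add (h : IsHawkinsSieve μ α) {m : ℕ} (hm : 2 ≤ m) {a b : Ω → ℝ}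
    (ha : IsBddMeas (sieveSigma α m) a) (hb : IsBddMeas (sieveSigma α m) b) :
    ∫ ω, memInd α m ω * a ω + b ω ∂μ = ∫ ω, hawkinsY (α ω) m * a ω + b ω ∂μ := by
  have := h.isProb
  rw [← integral_condExp (h.sieveSigma_le m)]
  exact integral_congr_ae (h.condExp_memInd_mul_add hm ha hb)

theorem isBddMeas_memInd_mul_memInd_mul (h : IsHawkinsSieve μ α) {m : ℕ} {g : Ω → ℝ}
    (hg : IsBddMeas (sieveSigma α m) g) :
    IsBddMeas (sieveSigma α (m + 3)) fun ω => memInd α m ω * memInd α (m + 2) ω * g ω :=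
  (((h.isBddMeas_memInd m).mono (sieveSigma_mono α (by omega))).mul
    (h.isBddMeas_memInd (m + 2))).mul (hg.mono (sieveSigma_mono α (by omega)))

theorem condExp_memInd_mul_memInd_mul (h : IsHawkinsSieve μ α) {m : ℕ} (hm : 2 ≤ m) {g : Ω → ℝ}
    (hg : IsBddMeas (sieveSigma α m) g) :
    μ[fun ω => memInd α m ω * memInd α (m + 2) ω * g ω | sieveSigma α m] =ᵐ[μ]
      fun ω => hawkinsY (α ω) m * ((1 - 1 / (m : ℝ)) * twinDensity (α ω) m * g ω) := by
  have := h.isProb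
  set f : Ω → ℝ := fun ω => memInd α m ω * memInd α (m + 2) ω * g ω
  have hY := h.isBddMeas_hawkinsY m
  have hI := h.isBddMeas_memInd m
  have hm1 : sieveSigma α m ≤ sieveSigma α (m + 1) := sieveSigma_mono α (Nat.le_succ m)
  have hm2 : sieveSigma α (m + 1) ≤ sieveSigma α (m + 2) := sieveSigma_mono α (Nat.le_succ _)
  have hIg : IsBddMeas (sieveSigma α (m + 1)) fun ω => memInd α m ω * g ω := hI.mul (hg.mono hm1)
  have hfm := h.isBddMeas_memInd_mul_memInd_mul hg
  have h3 : μ[f | sieveSigma α (m + 2 + 1)] =ᵐ[μ]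
      fun ω => memInd α (m + 2) ω * (memInd α m ω * g ω) + 0 := by
    rw [condExp_of_stronglyMeasurable (h.sieveSigma_le _) hfm.1
      (hfm.integrable (h.sieveSigma_le _))]
    exact ae_of_all _ fun ω => by ring
  have h2 := h.condExp_of_condExp_succ (by omega) (hIg.mono hm2) (IsBddMeas.const 0) h3
  have hB : IsBddMeas (sieveSigma α (m + 1)) fun ω =>
      memInd α m ω * g ω * (hawkinsY (α ω) m * (1 - 1 / (m : ℝ))) :=
    hIg.mul ((hY.mono hm1).mul (IsBddMeas.const _))
  have key : ∀ ω, hawkinsY (α ω) (m + 1) * memInd α m ω =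
      memInd α m ω * (hawkinsY (α ω) m * (1 - 1 / (m : ℝ))) := fun ω => by
    rw [hawkinsY_succ_eq_memInd]
    linear_combination (-hawkinsY (α ω) m / (m : ℝ)) * memInd_sq α m ω
  have h1 := h.condExp_of_condExp_succ (m := m + 1) (f := f) (by omega)
    ((IsBddMeas.const (-(1 / ((m : ℝ) + 1)))).mul hB) hB (by
      refine h2.trans (ae_of_all _ fun ω => ?_)
      simp only [add_zero]
      rw [show m + 2 = m + 1 + 1 from rfl, hawkinsY_succ_eq_memInd α (m + 1)]
      push_cast
      linear_combination (g ω * (1 - memInd α (m + 1) ω * (1 / ((m : ℝ) + 1)))) * key ω)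
  have h0 := h.condExp_of_condExp_succ (f := f) hm
    (((IsBddMeas.const (1 - 1 / (m : ℝ))).mul (h.isBddMeas_twinDensity m)).mul hg)
    (IsBddMeas.const 0) (by
      refine h1.trans (ae_of_all _ fun ω => ?_)
      simp only [twinDensity]
      linear_combination (-(1 / ((m : ℝ) + 1)) * g ω * (hawkinsY (α ω) m * (1 - 1 / (m : ℝ)))) *
        key ω)
  simpa using h0

theorem hawkinsY_inv_succ (h : IsHawkinsSieve μ α) {m : ℕ} (hm : 2 ≤ m) (ω : Ω) :
    (hawkinsY (α ω) (m + 1))⁻¹ =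
      memInd α m ω * ((hawkinsY (α ω) m)⁻¹ * (1 / ((m : ℝ) - 1))) + (hawkinsY (α ω) m)⁻¹ := by
  have hY := (hawkinsY_pos (h.mem_ge_two ω) m).ne'
  have hm' : (2 : ℝ) ≤ m := by exact_mod_cast hm
  have hm1 : (m : ℝ) - 1 ≠ 0 := by linarith
  have hm0 : (m : ℝ) ≠ 0 := by linarith
  rw [hawkinsY_succ]
  by_cases hω : m ∈ α ω
  · have : (1 : ℝ) - 1 / m = (m - 1) / m := by field_simp
    simp only [hω, if_true, memInd, Set.indicator, Set.mem_ofPred_eq]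
    rw [this]
    field_simp
    ring
  · simp [memInd, hω]

theorem integral_hawkinsY_inv (h : IsHawkinsSieve μ α) (k : ℕ) :
    ∫ ω, (hawkinsY (α ω) (k + 2))⁻¹ ∂μ = 1 + harmonic k := by
  have := h.isProb
  induction k with
  | zero => simp [fun ω => hawkinsY_two (h.mem_ge_two ω)]
  | succ k ih =>
    have hb := h.isBddMeas_hawkinsY_inv (k + 2)
    simp_rw [show k + 1 + 2 = k + 2 + 1 from rfl, h.hawkinsY_inv_succ (m := k + 2) (by omega)]
    rw [h.integral_memInd_mul_add (by omega) (hb.mul (IsBddMeas.const _)) hb]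
    have : ∀ ω, hawkinsY (α ω) (k + 2) * ((hawkinsY (α ω) (k + 2))⁻¹ *
        (1 / (((k + 2 : ℕ) : ℝ) - 1))) + (hawkinsY (α ω) (k + 2))⁻¹ =
        ((k : ℝ) + 1)⁻¹ + (hawkinsY (α ω) (k + 2))⁻¹ := fun ω => by
      have hY := (hawkinsY_pos (h.mem_ge_two ω) (k + 2)).ne'
      rw [← mul_assoc, mul_inv_cancel₀ hY]
      push_cast
      ring
    simp_rw [this]
    rw [integral_add (integrable_const _) (hb.integrable (h.sieveSigma_le _)), ih, harmonic_succ]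
    simp
    ring

theorem ae_exists_tendsto_hawkinsY_inv_sub_harmonic (h : IsHawkinsSieve μ α) :
    ∀ᵐ ω ∂μ, ∃ l, Tendsto (fun k : ℕ => (hawkinsY (α ω) (k + 2))⁻¹ - harmonic k)
      atTop (nhds l) := by
  have := h.isProb
  set D : ℕ → Ω → ℝ := fun k ω =>
    memInd α (k + 2) ω * ((hawkinsY (α ω) (k + 2))⁻¹ * (1 / ((k : ℝ) + 1))) + -(1 / ((k : ℝ) + 1))
    with hD
  have ha : ∀ k, IsBddMeas (sieveSigma α (k + 2)) fun ω =>
      (hawkinsY (α ω) (k + 2))⁻¹ * (1 / ((k : ℝ) + 1)) := fun k =>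
    (h.isBddMeas_hawkinsY_inv (k + 2)).mul (IsBddMeas.const _)
  have hYne : ∀ k ω, hawkinsY (α ω) (k + 2) ≠ 0 := fun k ω =>
    (hawkinsY_pos (h.mem_ge_two ω) (k + 2)).ne'
  have hsq : ∀ k, ∫ ω, D k ω ^ 2 ∂μ ≤ 4 * (1 / ((k : ℝ) + 1) ^ (3 / 2 : ℝ)) := by
    intro k
    have h1 : ∀ ω, D k ω ^ 2 = memInd α (k + 2) ω *
        (((hawkinsY (α ω) (k + 2))⁻¹ * (1 / ((k : ℝ) + 1))) ^ 2 - 2 * (1 / ((k : ℝ) + 1)) *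
          ((hawkinsY (α ω) (k + 2))⁻¹ * (1 / ((k : ℝ) + 1)))) + (1 / ((k : ℝ) + 1)) ^ 2 :=
      fun ω => by
        simp only [hD]
        linear_combination ((hawkinsY (α ω) (k + 2))⁻¹ * (1 / ((k : ℝ) + 1))) ^ 2 *
          memInd_sq α (k + 2) ω
    simp_rw [h1]
    rw [h.integral_memInd_mul_add (by omega) ((ha k).sq.sub ((IsBddMeas.const _).mul (ha k)))
      (IsBddMeas.const _)]
    have h2 : ∀ ω, hawkinsY (α ω) (k + 2) *
        (((hawkinsY (α ω) (k + 2))⁻¹ * (1 / ((k : ℝ) + 1))) ^ 2 - 2 * (1 / ((k : ℝ) + 1)) *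
          ((hawkinsY (α ω) (k + 2))⁻¹ * (1 / ((k : ℝ) + 1)))) + (1 / ((k : ℝ) + 1)) ^ 2 =
        (hawkinsY (α ω) (k + 2))⁻¹ * (1 / ((k : ℝ) + 1)) ^ 2 - (1 / ((k : ℝ) + 1)) ^ 2 :=
      fun ω => by
        have := hYne k ω
        field_simp
        ring
    simp_rw [h2]
    rw [integral_sub (((h.isBddMeas_hawkinsY_inv (k + 2)).mul (IsBddMeas.const _)).integrable
      (h.sieveSigma_le _)) (integrable_const _), integral_mul_const, h.integral_hawkinsY_inv]
    simp only [integral_const, probReal_univ, one_smul]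
    have hk : (0 : ℝ) < (k : ℝ) + 1 := by positivity
    have h3 : (harmonic k : ℝ) ≤ 1 + Real.log k := harmonic_le_one_add_log k
    have h4 : Real.log k ≤ 2 * ((k : ℝ) + 1) ^ (1 / 2 : ℝ) := by
      have h5 := Real.log_le_rpow_div (x := (k : ℝ)) (ε := 1 / 2) (by positivity) (by norm_num)
      have h6 : (k : ℝ) ^ (1 / 2 : ℝ) ≤ ((k : ℝ) + 1) ^ (1 / 2 : ℝ) :=
        Real.rpow_le_rpow (by positivity) (by linarith) (by norm_num)
      linarith
    have h7 : (1 : ℝ) ≤ ((k : ℝ) + 1) ^ (1 / 2 : ℝ) :=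
      Real.one_le_rpow (by linarith [Nat.cast_nonneg (α := ℝ) k]) (by norm_num)
    have h8 : ((k : ℝ) + 1) ^ (2 : ℕ) =
        ((k : ℝ) + 1) ^ (3 / 2 : ℝ) * ((k : ℝ) + 1) ^ (1 / 2 : ℝ) := by
      rw [← Real.rpow_add hk, ← Real.rpow_natCast]
      norm_num
    have h9 : (0 : ℝ) < ((k : ℝ) + 1) ^ (3 / 2 : ℝ) := by positivity
    have h10 : (0 : ℝ) < ((k : ℝ) + 1) ^ (1 / 2 : ℝ) := by positivity
    rw [one_div, inv_pow, h8, ← sub_one_mul, add_sub_cancel_left, ← div_eq_mul_inv,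
      ← div_eq_mul_one_div, div_le_div_iff₀ (by positivity) h9]
    nlinarith
  have hconv := ae_exists_tendsto_sum_of_condExp_eq_zero (μ := μ) h.filtration (D := D)
    (fun k => ((h.isBddMeas_memInd (k + 2)).mul ((ha k).mono
      (sieveSigma_mono α (Nat.le_succ _)))).add (IsBddMeas.const _))
    (fun k => (h.condExp_memInd_mul_add (by omega) (ha k) (IsBddMeas.const _)).trans
      (ae_of_all _ fun ω => by
        have := hYne k ω
        simp only [Pi.zero_apply]
        field_simp
        ring))
    (Summable.of_nonneg_of_le (fun k => integral_nonneg fun ω => sq_nonneg _) hsq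
      (Summable.mul_left 4 (by
        have := (summable_nat_add_iff 1).mpr
          (Real.summable_one_div_nat_rpow.mpr (show (1 : ℝ) < 3 / 2 by norm_num))
        simpa using this)))
  filter_upwards [hconv] with ω ⟨l, hl⟩
  refine ⟨1 + l, (hl.const_add 1).congr fun n => ?_⟩
  induction n with
  | zero => simp [hawkinsY_two (h.mem_ge_two ω)]
  | succ n ih =>
    rw [Finset.sum_range_succ, ← add_assoc, ih, show n + 1 + 2 = n + 2 + 1 from rfl,
      h.hawkinsY_inv_succ (m := n + 2) (by omega), harmonic_succ]
    simp only [hD]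
    push_cast
    ring

theorem ae_exists_tendsto_sum_twinTerm_sub (h : IsHawkinsSieve μ α) :
    ∀ᵐ ω ∂μ, ∃ l, Tendsto (fun n : ℕ => ∑ k ∈ Finset.range n,
      (((k : ℝ) + 1) ^ (3 / 4 : ℝ))⁻¹ * (twinTerm (α ω) (k + 2) -
        (1 - 1 / ((k + 2 : ℕ) : ℝ)) * hawkinsY (α ω) (k + 2))) atTop (nhds l) := by
  have := h.isProb
  have hdinv := fun k => h.isBddMeas_twinDensity_inv (m := k + 2) (by omega)
  have hT : ∀ k, IsBddMeas (sieveSigma α (k + 2 + 3)) fun ω => twinTerm (α ω) (k + 2) := fun k => by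
    simp_rw [twinTerm_eq_memInd]
    exact h.isBddMeas_memInd_mul_memInd_mul (hdinv k)
  have he : ∀ k, IsBddMeas (sieveSigma α (k + 2)) fun ω =>
      (1 - 1 / ((k + 2 : ℕ) : ℝ)) * hawkinsY (α ω) (k + 2) := fun k =>
    (IsBddMeas.const _).mul (h.isBddMeas_hawkinsY (k + 2))
  have hD : ∀ k, IsBddMeas (sieveSigma α (k + 2 + 3)) fun ω => twinTerm (α ω) (k + 2) -
      (1 - 1 / ((k + 2 : ℕ) : ℝ)) * hawkinsY (α ω) (k + 2) := fun k =>
    (hT k).sub ((he k).mono (sieveSigma_mono α (by omega)))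
  have hd : ∀ k ω, twinDensity (α ω) (k + 2) ≠ 0 := fun k ω =>
    (twinDensity_pos (h.mem_ge_two ω) (by omega)).ne'
  have hc : ∀ k, μ[fun ω => twinTerm (α ω) (k + 2) -
      (1 - 1 / ((k + 2 : ℕ) : ℝ)) * hawkinsY (α ω) (k + 2) | sieveSigma α (k + 2)] =ᵐ[μ] 0 := by
    intro k
    have h1 := condExp_sub (μ := μ) ((hT k).integrable (h.sieveSigma_le _))
      ((he k).integrable (h.sieveSigma_le _)) (sieveSigma α (k + 2))
    have h2 := h.condExp_memInd_mul_memInd_mul (m := k + 2) (by omega) (hdinv k)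
    have h3 := condExp_of_stronglyMeasurable (μ := μ) (h.sieveSigma_le _) (he k).1
      ((he k).integrable (h.sieveSigma_le _))
    simp_rw [← twinTerm_eq_memInd] at h2
    refine h1.trans ?_
    filter_upwards [h2] with ω h2
    rw [Pi.sub_apply, h2, h3, mul_assoc (1 - 1 / ((k + 2 : ℕ) : ℝ)), mul_inv_cancel₀ (hd k ω)]
    simp only [Pi.zero_apply]
    ring
  have hE : ∀ k, ∫ ω, (twinTerm (α ω) (k + 2) -
      (1 - 1 / ((k + 2 : ℕ) : ℝ)) * hawkinsY (α ω) (k + 2)) ^ 2 ∂μ ≤ 5 := by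
    intro k
    have hf : (0 : ℝ) ≤ 1 - 1 / ((k + 2 : ℕ) : ℝ) ∧ 1 - 1 / ((k + 2 : ℕ) : ℝ) ≤ 1 := by
      have h0 : (0 : ℝ) ≤ 1 / ((k + 2 : ℕ) : ℝ) := by positivity
      have h1 : 1 / ((k + 2 : ℕ) : ℝ) ≤ 1 / 1 :=
        one_div_le_one_div_of_le (by norm_num) (by push_cast; linarith [Nat.cast_nonneg (α := ℝ) k])
      constructor <;> linarith
    have hg : IsBddMeas (sieveSigma α (k + 2)) fun ω => (twinDensity (α ω) (k + 2))⁻¹ ^ 2 :=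
      (hdinv k).sq
    have hTsq : ∀ ω, twinTerm (α ω) (k + 2) ^ 2 =
        memInd α (k + 2) ω * memInd α (k + 2 + 2) ω * (twinDensity (α ω) (k + 2))⁻¹ ^ 2 :=
      fun ω => by
        rw [twinTerm_eq_memInd, mul_pow, mul_pow, memInd_sq, memInd_sq]
    have hT2 : ∫ ω, twinTerm (α ω) (k + 2) ^ 2 ∂μ ≤ 3 / 2 := by
      simp_rw [hTsq]
      rw [← integral_condExp (h.sieveSigma_le (k + 2)),
        integral_congr_ae (h.condExp_memInd_mul_memInd_mul (by omega) hg)]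
      have hle : ∀ ω, hawkinsY (α ω) (k + 2) * ((1 - 1 / ((k + 2 : ℕ) : ℝ)) *
          twinDensity (α ω) (k + 2) * (twinDensity (α ω) (k + 2))⁻¹ ^ 2) ≤ 3 / 2 := fun ω => by
        have hdp := twinDensity_pos (h.mem_ge_two ω) (show 2 ≤ k + 2 by omega)
        have hl := two_thirds_mul_le_twinDensity (h.mem_ge_two ω) (show 2 ≤ k + 2 by omega)
        have hY := hawkinsY_pos (h.mem_ge_two ω) (k + 2)
        have e : hawkinsY (α ω) (k + 2) * ((1 - 1 / ((k + 2 : ℕ) : ℝ)) *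
          twinDensity (α ω) (k + 2) * (twinDensity (α ω) (k + 2))⁻¹ ^ 2) =
          (1 - 1 / ((k + 2 : ℕ) : ℝ)) * hawkinsY (α ω) (k + 2) / twinDensity (α ω) (k + 2) := by
          field_simp
        rw [e, div_le_iff₀ hdp]
        nlinarith
      calc _ ≤ ∫ _, (3 / 2 : ℝ) ∂μ := integral_mono
            (((h.isBddMeas_hawkinsY _).mul (((IsBddMeas.const _).mul
              (h.isBddMeas_twinDensity _)).mul hg)).integrable (h.sieveSigma_le _))
            (integrable_const _) hle
        _ = 3 / 2 := by simp
    calc _ ≤ ∫ ω, 2 * twinTerm (α ω) (k + 2) ^ 2 + 2 ∂μ := by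
          refine integral_mono ((hD k).sq.integrable (h.sieveSigma_le _))
            ((((IsBddMeas.const 2).mul (hT k).sq).add (IsBddMeas.const 2)).integrable
              (h.sieveSigma_le _)) fun ω => ?_
          have hY := hawkinsY_pos (h.mem_ge_two ω) (k + 2)
          have hY1 := hawkinsY_le_one (h.mem_ge_two ω) (k + 2)
          have h1 := mul_nonneg hf.1 hY.le
          have h2 := mul_le_one₀ hf.2 hY.le hY1
          simp only
          nlinarith [sq_nonneg (twinTerm (α ω) (k + 2) +
            (1 - 1 / ((k + 2 : ℕ) : ℝ)) * hawkinsY (α ω) (k + 2))]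
      _ = 2 * ∫ ω, twinTerm (α ω) (k + 2) ^ 2 ∂μ + 2 := by
          rw [integral_add (((IsBddMeas.const 2).mul (hT k).sq).integrable (h.sieveSigma_le _))
            (integrable_const _), integral_const_mul]
          simp
      _ ≤ 5 := by linarith
  refine ae_exists_tendsto_sum_of_condExp_eq_zero_three (μ := μ) h.filtration
    (D := fun k ω => (((k : ℝ) + 1) ^ (3 / 4 : ℝ))⁻¹ * (twinTerm (α ω) (k + 2) -
      (1 - 1 / ((k + 2 : ℕ) : ℝ)) * hawkinsY (α ω) (k + 2)))
    (fun k => (IsBddMeas.const _).mul (hD k)) (fun k => ?_) ?_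
  · have h1 := condExp_smul (μ := μ) (((k : ℝ) + 1) ^ (3 / 4 : ℝ))⁻¹ (fun ω =>
      twinTerm (α ω) (k + 2) - (1 - 1 / ((k + 2 : ℕ) : ℝ)) * hawkinsY (α ω) (k + 2))
      (sieveSigma α (k + 2))
    refine EventuallyEq.trans h1 ?_
    filter_upwards [hc k] with ω h2
    rw [Pi.smul_apply, h2]
    simp
  · refine Summable.of_nonneg_of_le (fun k => integral_nonneg fun ω => sq_nonneg _) (fun k => ?_)
      (Summable.mul_left (f := fun k : ℕ => 1 / ((k : ℝ) + 1) ^ (3 / 2 : ℝ)) 5 (by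
        have := (summable_nat_add_iff 1).mpr
          (Real.summable_one_div_nat_rpow.mpr (show (1 : ℝ) < 3 / 2 by norm_num))
        simpa using this))
    have hp : ((((k : ℝ) + 1) ^ (3 / 4 : ℝ))⁻¹) ^ 2 = 1 / ((k : ℝ) + 1) ^ (3 / 2 : ℝ) := by
      rw [inv_pow, one_div, ← Real.rpow_natCast, ← Real.rpow_mul (by positivity)]
      norm_num
    simp_rw [mul_pow, hp]
    rw [integral_const_mul, mul_comm]
    exact mul_le_mul_of_nonneg_right (hE k) (by positivity)

end IsHawkinsSieve

end HawkinsConditional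

section RealSequences

/-- **Kronecker's lemma**. -/
theorem tendsto_sum_div_of_tendsto_sum_inv_mul {a b : ℕ → ℝ} (hb : Monotone b)
    (hpos : ∀ n, 0 < b n) (hbt : Tendsto b atTop atTop) {l : ℝ}
    (h : Tendsto (fun n => ∑ k ∈ Finset.range n, (b k)⁻¹ * a k) atTop (nhds l)) :
    Tendsto (fun n => (∑ k ∈ Finset.range n, a k) / b n) atTop (nhds 0) := by
  set s : ℕ → ℝ := fun n => ∑ k ∈ Finset.range n, (b k)⁻¹ * a k - l with hs
  have hs0 : Tendsto s atTop (nhds 0) := by simpa using h.sub_const l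
  have hparts : ∀ n, ∑ k ∈ Finset.range n, a k =
      b n * s n - b 0 * s 0 - ∑ k ∈ Finset.range n, (b (k + 1) - b k) * s (k + 1) := by
    intro n
    induction n with
    | zero => simp
    | succ n ih =>
      have e : a n = b n * (s (n + 1) - s n) := by
        have := (hpos n).ne'
        simp only [hs, Finset.sum_range_succ]
        field_simp
        ring
      rw [Finset.sum_range_succ, Finset.sum_range_succ _ n, ih, e]
      ring
  have htel : ∀ n, ∑ k ∈ Finset.range n, (b (k + 1) - b k) = b n - b 0 :=
    fun n => Finset.sum_range_sub b n
  have ho : (fun k => (b (k + 1) - b k) * s (k + 1)) =o[atTop] fun k => b (k + 1) - b k := by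
    have := (isBigO_refl (fun k => b (k + 1) - b k) atTop).mul_isLittleO
      ((isLittleO_one_iff ℝ).mpr (hs0.comp (tendsto_add_atTop_nat 1)))
    simpa using this
  have hsum := ho.sum_range (fun n => sub_nonneg.mpr (hb (Nat.le_succ n))) (by
    simp_rw [htel]
    exact tendsto_atTop_add_const_right _ _ hbt)
  simp_rw [htel] at hsum
  have hO : (fun n => b n - b 0) =O[atTop] b := by
    refine IsBigO.of_bound 1 (Eventually.of_forall fun n => ?_)
    have h0 := hb (Nat.zero_le n)
    rw [Real.norm_of_nonneg (sub_nonneg.mpr h0), Real.norm_of_nonneg (hpos n).le]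
    linarith [hpos 0]
  have h1 := (hsum.trans_isBigO hO).tendsto_div_nhds_zero
  have h2 : Tendsto (fun n => b 0 * s 0 / b n) atTop (nhds 0) := hbt.const_div_atTop _
  have h3 := (hs0.sub h2).sub h1
  simp only [sub_zero] at h3
  refine h3.congr fun n => ?_
  rw [hparts]
  have := (hpos n).ne'
  field_simp

theorem tendsto_log_natCast_atTop : Tendsto (fun n : ℕ => Real.log n) atTop atTop :=
  Real.tendsto_log_atTop.comp tendsto_natCast_atTop_atTop

theorem tendsto_log_add_div_log (c : ℕ) :
    Tendsto (fun n : ℕ => Real.log ((n : ℝ) + c) / Real.log n) atTop (nhds 1) := by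
  have h1 : Tendsto (fun n : ℕ => Real.log (((n : ℝ) + c) / n) * (Real.log n)⁻¹) atTop
      (nhds (0 * 0)) := by
    refine Tendsto.mul ?_ (tendsto_inv_atTop_zero.comp tendsto_log_natCast_atTop)
    have h2 := (tendsto_natCast_div_add_atTop (𝕜 := ℝ) (c : ℝ)).inv₀ one_ne_zero
    have h3 := h2.log (by norm_num)
    simpa using h3
  have h4 := h1.const_add 1
  rw [mul_zero, add_zero] at h4
  refine h4.congr' ?_
  filter_upwards [eventually_ge_atTop 2] with n hn
  have hn' : (2 : ℝ) ≤ n := by exact_mod_cast hn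
  have hl : Real.log n ≠ 0 := (Real.log_pos (by linarith)).ne'
  rw [Real.log_div (by positivity) (by positivity)]
  field_simp
  ring

/-- If `u k ~ 1 / log k`, then `∑_{k < n} u k ~ n / log n`. -/
theorem tendsto_sum_mul_log_div {u : ℕ → ℝ}
    (hu : Tendsto (fun k : ℕ => u k * Real.log k) atTop (nhds 1)) :
    Tendsto (fun n : ℕ => (∑ k ∈ Finset.range n, u k) * Real.log n / n) atTop (nhds 1) := by
  set L : ℕ → ℝ := fun k => Real.log ((k : ℝ) + 3) with hL
  set t : ℕ → ℝ := fun k => ((k : ℝ) + 3) / L k with ht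
  set d : ℕ → ℝ := fun k => t (k + 1) - t k with hd
  have hL1 : ∀ k, 1 < L k := fun k => by
    rw [hL, Real.lt_log_iff_exp_lt (by positivity)]
    have := Real.exp_one_lt_d9
    linarith [Nat.cast_nonneg (α := ℝ) k]
  have hLt : Tendsto L atTop atTop :=
    Real.tendsto_log_atTop.comp
      (tendsto_atTop_add_const_right _ _ tendsto_natCast_atTop_atTop)
  have hdL : ∀ k, d k * L (k + 1) = ((k : ℝ) + 4) - ((k : ℝ) + 3) * (L (k + 1) / L k) := fun k => by
    have h1 := (zero_lt_one.trans (hL1 k)).ne'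
    have h2 := (zero_lt_one.trans (hL1 (k + 1))).ne'
    simp only [hd, ht]
    push_cast
    field_simp
    ring
  have hle : ∀ k, d k * L (k + 1) ≤ 1 := fun k => by
    have h1 : 1 ≤ L (k + 1) / L k := by
      rw [one_le_div (zero_lt_one.trans (hL1 k))]
      refine Real.log_le_log (by positivity) ?_
      push_cast
      linarith
    rw [hdL]
    nlinarith [Nat.cast_nonneg (α := ℝ) k]
  have hge : ∀ k, 1 - (L k)⁻¹ ≤ d k * L (k + 1) := fun k => by
    have hk : (0 : ℝ) < (k : ℝ) + 3 := by positivity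
    have h0 := zero_lt_one.trans (hL1 k)
    have h1 : L (k + 1) ≤ L k + 1 / ((k : ℝ) + 3) := by
      have h2 := Real.log_le_sub_one_of_pos (x := (((k + 1 : ℕ) : ℝ) + 3) / ((k : ℝ) + 3))
        (by positivity)
      rw [Real.log_div (by positivity) (by positivity)] at h2
      have h3 : (((k + 1 : ℕ) : ℝ) + 3) / ((k : ℝ) + 3) - 1 = 1 / ((k : ℝ) + 3) := by
        push_cast
        field_simp
        ring
      simp only [hL]
      linarith
    have h4 : ((k : ℝ) + 3) * (L (k + 1) / L k) ≤ ((k : ℝ) + 3) + (L k)⁻¹ := by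
      calc ((k : ℝ) + 3) * (L (k + 1) / L k)
          ≤ ((k : ℝ) + 3) * ((L k + 1 / ((k : ℝ) + 3)) / L k) := by gcongr
        _ = ((k : ℝ) + 3) + (L k)⁻¹ := by field_simp
    rw [hdL]
    linarith
  have hdpos : ∀ k, 0 < d k := fun k => by
    have h1 : (L k)⁻¹ < 1 := inv_lt_one_of_one_lt₀ (hL1 k)
    exact pos_of_mul_pos_left (lt_of_lt_of_le (by linarith) (hge k))
      (zero_lt_one.trans (hL1 (k + 1))).le
  have hdL1 : Tendsto (fun k => d k * L (k + 1)) atTop (nhds 1) := by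
    refine tendsto_of_tendsto_of_tendsto_of_le_of_le ?_ tendsto_const_nhds hge hle
    simpa using (tendsto_inv_atTop_zero.comp hLt).const_sub 1
  have hud : Tendsto (fun k => u k / d k) atTop (nhds 1) := by
    have h1 := (hu.mul (tendsto_log_add_div_log 4)).div hdL1 one_ne_zero
    simp only [mul_one, div_one] at h1
    refine h1.congr' ?_
    filter_upwards [eventually_ge_atTop 2] with k hk
    have hk' : (2 : ℝ) ≤ k := by exact_mod_cast hk
    have hl : Real.log k ≠ 0 := (Real.log_pos (by linarith)).ne'
    have hd0 := (hdpos k).ne'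
    have hL0 := (zero_lt_one.trans (hL1 (k + 1))).ne'
    have e : Real.log ((k : ℝ) + (4 : ℕ)) = L (k + 1) := by
      simp only [hL]
      congr 1
      push_cast
      ring
    simp only [Pi.div_apply]
    rw [e]
    field_simp
  have htt : Tendsto t atTop atTop := by
    have h1 : Tendsto (fun k : ℕ => ((k : ℝ) + 3) ^ (1 / 2 : ℝ) / 2) atTop atTop :=
      ((tendsto_rpow_atTop (by norm_num)).comp
        (tendsto_atTop_add_const_right _ _ tendsto_natCast_atTop_atTop)).atTop_div_const
        (by norm_num)
    refine tendsto_atTop_mono (fun k => ?_) h1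
    have hk : (0 : ℝ) < (k : ℝ) + 3 := by positivity
    have h2 := Real.log_le_rpow_div hk.le (show (0 : ℝ) < 1 / 2 by norm_num)
    have h3 : ((k : ℝ) + 3) ^ (1 / 2 : ℝ) * ((k : ℝ) + 3) ^ (1 / 2 : ℝ) = (k : ℝ) + 3 := by
      rw [← Real.rpow_add hk]
      norm_num
    have h4 : (0 : ℝ) < ((k : ℝ) + 3) ^ (1 / 2 : ℝ) := by positivity
    simp only [ht]
    rw [div_le_div_iff₀ (by norm_num) (zero_lt_one.trans (hL1 k))]
    simp only [hL]
    nlinarith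
  have htel : ∀ n, ∑ k ∈ Finset.range n, d k = t n - t 0 := fun n => Finset.sum_range_sub t n
  have ho : (fun k => u k - d k) =o[atTop] d :=
    (isEquivalent_of_tendsto_one hud).isLittleO
  have hsum := ho.sum_range (fun n => (hdpos n).le) (by
    simp_rw [htel]
    exact tendsto_atTop_add_const_right _ _ htt)
  simp_rw [Finset.sum_sub_distrib, htel] at hsum
  have htpos : ∀ k, 0 < t k := fun k => div_pos (by positivity) (zero_lt_one.trans (hL1 k))
  have hratio : Tendsto (fun n => (t n - t 0) / t n) atTop (nhds 1) := by
    have h1 := (htt.const_div_atTop (t 0)).const_sub 1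
    rw [sub_zero] at h1
    refine h1.congr fun n => ?_
    have := (htpos n).ne'
    field_simp
  have hO : (fun n => t n - t 0) =O[atTop] t :=
    (isEquivalent_of_tendsto_one hratio).isBigO
  have h1 := (hsum.trans_isBigO hO).tendsto_div_nhds_zero.add hratio
  have h2 : Tendsto (fun n => (∑ k ∈ Finset.range n, u k) / t n) atTop (nhds 1) := by
    rw [zero_add] at h1
    refine h1.congr fun n => ?_
    rw [← add_div]
    simp
  have h3 := (h2.div (tendsto_log_add_div_log 3) one_ne_zero).div
    (tendsto_natCast_div_add_atTop (𝕜 := ℝ) 3) one_ne_zero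
  simp only [div_one] at h3
  refine h3.congr' ?_
  filter_upwards [eventually_ge_atTop 2] with n hn
  have hn' : (2 : ℝ) ≤ n := by exact_mod_cast hn
  have hl : Real.log n ≠ 0 := (Real.log_pos (by linarith)).ne'
  have hL0 := (zero_lt_one.trans (hL1 n)).ne'
  have e : Real.log ((n : ℝ) + (3 : ℕ)) = L n := by simp [hL]
  simp only [Pi.div_apply, ht]
  rw [e]
  field_simp

theorem tendsto_add_one_rpow_mul_log_div :
    Tendsto (fun n : ℕ => ((n : ℝ) + 1) ^ (3 / 4 : ℝ) * Real.log n / n) atTop (nhds 0) := by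
  have h1 : Tendsto (fun n : ℕ => 2 * (Real.log n / (n : ℝ) ^ (1 / 4 : ℝ))) atTop (nhds 0) := by
    have h2 := ((isLittleO_log_rpow_atTop (r := 1 / 4) (by norm_num)).tendsto_div_nhds_zero.comp
      (tendsto_natCast_atTop_atTop (R := ℝ))).const_mul 2
    simpa using h2
  refine squeeze_zero' ?_ ?_ h1
  · filter_upwards [eventually_ge_atTop 1] with n hn
    have hn' : (1 : ℝ) ≤ n := by exact_mod_cast hn
    have := Real.log_nonneg hn'
    positivity
  · filter_upwards [eventually_ge_atTop 1] with n hn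
    have hn' : (1 : ℝ) ≤ n := by exact_mod_cast hn
    have hn0 : (0 : ℝ) < n := by linarith
    have hl := Real.log_nonneg hn'
    have h3 : ((n : ℝ) + 1) ^ (3 / 4 : ℝ) ≤ 2 * (n : ℝ) ^ (3 / 4 : ℝ) :=
      calc ((n : ℝ) + 1) ^ (3 / 4 : ℝ) ≤ (2 * n : ℝ) ^ (3 / 4 : ℝ) :=
            Real.rpow_le_rpow (by positivity) (by linarith) (by norm_num)
        _ = 2 ^ (3 / 4 : ℝ) * (n : ℝ) ^ (3 / 4 : ℝ) := Real.mul_rpow (by norm_num) hn0.le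
        _ ≤ 2 ^ (1 : ℝ) * (n : ℝ) ^ (3 / 4 : ℝ) := by
            gcongr
            · norm_num
            · norm_num
        _ = 2 * (n : ℝ) ^ (3 / 4 : ℝ) := by rw [Real.rpow_one]
    have h4 : (n : ℝ) ^ (3 / 4 : ℝ) * (n : ℝ) ^ (1 / 4 : ℝ) = n := by
      rw [← Real.rpow_add hn0]
      norm_num
    have h5 : (0 : ℝ) < (n : ℝ) ^ (1 / 4 : ℝ) := by positivity
    rw [← mul_div_assoc, div_le_div_iff₀ hn0 h5]
    calc ((n : ℝ) + 1) ^ (3 / 4 : ℝ) * Real.log n * (n : ℝ) ^ (1 / 4 : ℝ)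
        ≤ 2 * (n : ℝ) ^ (3 / 4 : ℝ) * Real.log n * (n : ℝ) ^ (1 / 4 : ℝ) := by gcongr
      _ = 2 * Real.log n * ((n : ℝ) ^ (3 / 4 : ℝ) * (n : ℝ) ^ (1 / 4 : ℝ)) := by ring
      _ = 2 * Real.log n * n := by rw [h4]

end RealSequences

theorem tendsto_hawkinsY_mul_log {A : Set ℕ} {l : ℝ}
    (hl : Tendsto (fun k : ℕ => (hawkinsY A (k + 2))⁻¹ - harmonic k) atTop (nhds l)) :
    Tendsto (fun k : ℕ => hawkinsY A (k + 2) * Real.log k) atTop (nhds 1) := by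
  have h1 := (hl.add Real.tendsto_harmonic_sub_log).mul
    (tendsto_inv_atTop_zero.comp tendsto_log_natCast_atTop)
  rw [mul_zero] at h1
  have h2 := (h1.add_const 1).inv₀ (by norm_num)
  rw [zero_add, inv_one] at h2
  refine h2.congr' ?_
  filter_upwards [eventually_ge_atTop 2] with k hk
  have hk' : (2 : ℝ) ≤ k := by exact_mod_cast hk
  have hlog : Real.log k ≠ 0 := (Real.log_pos (by linarith)).ne'
  have e : ((hawkinsY A (k + 2))⁻¹ - harmonic k + (harmonic k - Real.log k)) * (Real.log k)⁻¹ + 1 =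
      (hawkinsY A (k + 2) * Real.log k)⁻¹ := by
    rw [mul_inv]
    field_simp
    ring
  simp only [Function.comp_apply]
  rw [e, inv_inv]

theorem piHat_succ {A : Set ℕ} (hA : ∀ n ∈ A, 2 ≤ n) (n : ℕ) :
    piHat A (n + 1) = ∑ k ∈ Finset.range n, twinTerm A (k + 2) := by
  have h0 : twinTerm A 0 = 0 := if_neg fun h => by simpa using hA 0 h.1
  have h1 : twinTerm A 1 = 0 := if_neg fun h => by simpa using hA 1 h.1
  rw [piHat_eq_sum_twinTerm, Finset.sum_range_succ', Finset.sum_range_succ', h0, h1]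
  simp

theorem tendsto_piHat_mul_log_div {A : Set ℕ} (hA : ∀ n ∈ A, 2 ≤ n) {l l' : ℝ}
    (hl : Tendsto (fun k : ℕ => (hawkinsY A (k + 2))⁻¹ - harmonic k) atTop (nhds l))
    (hl' : Tendsto (fun n : ℕ => ∑ k ∈ Finset.range n, (((k : ℝ) + 1) ^ (3 / 4 : ℝ))⁻¹ *
      (twinTerm A (k + 2) - (1 - 1 / ((k + 2 : ℕ) : ℝ)) * hawkinsY A (k + 2))) atTop (nhds l')) :
    Tendsto (fun n : ℕ => piHat A n * Real.log n / (n : ℝ)) atTop (nhds 1) := by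
  have hu : Tendsto (fun k : ℕ => (1 - 1 / ((k + 2 : ℕ) : ℝ)) * hawkinsY A (k + 2) * Real.log k)
      atTop (nhds 1) := by
    have h1 : Tendsto (fun k : ℕ => 1 - 1 / ((k + 2 : ℕ) : ℝ)) atTop (nhds (1 - 0)) :=
      ((tendsto_const_div_atTop_nhds_zero_nat (1 : ℝ)).comp (tendsto_add_atTop_nat 2)).const_sub 1
    have h2 := h1.mul (tendsto_hawkinsY_mul_log hl)
    rw [sub_zero, one_mul] at h2
    exact h2.congr fun k => (mul_assoc _ _ _).symm
  have hsum := tendsto_sum_mul_log_div hu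
  have hkr := tendsto_sum_div_of_tendsto_sum_inv_mul
    (b := fun k : ℕ => ((k : ℝ) + 1) ^ (3 / 4 : ℝ))
    (fun a b hab => Real.rpow_le_rpow (by positivity)
      (by have : (a : ℝ) ≤ b := by exact_mod_cast hab
          linarith) (by norm_num))
    (fun n => by positivity)
    ((tendsto_rpow_atTop (by norm_num)).comp
      (tendsto_atTop_add_const_right _ _ tendsto_natCast_atTop_atTop)) hl'
  have hW := (hkr.mul tendsto_add_one_rpow_mul_log_div).add hsum
  rw [mul_zero, zero_add] at hW
  rw [← tendsto_add_atTop_iff_nat 1]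
  have hfin := (hW.mul (tendsto_log_add_div_log 1)).mul
    (tendsto_natCast_div_add_atTop (𝕜 := ℝ) 1)
  simp only [mul_one] at hfin
  refine hfin.congr' ?_
  filter_upwards [eventually_ge_atTop 2] with n hn
  have hn' : (2 : ℝ) ≤ n := by exact_mod_cast hn
  have hlog : Real.log n ≠ 0 := (Real.log_pos (by linarith)).ne'
  have hp : (0 : ℝ) < ((n : ℝ) + 1) ^ (3 / 4 : ℝ) := by positivity
  rw [piHat_succ hA, Finset.sum_sub_distrib]
  push_cast
  field_simp
  ring

theorem piHat_asymptotic {Ω : Type*} [MeasurableSpace Ω] (μ : Measure Ω)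
    (α : Ω → Set ℕ) (h : IsHawkinsSieve μ α) :
    ∀ᵐ ω ∂μ, Tendsto (fun n : ℕ => piHat (α ω) n * Real.log n / (n : ℝ))
      atTop (nhds 1) := by
  filter_upwards [h.ae_exists_tendsto_hawkinsY_inv_sub_harmonic,
    h.ae_exists_tendsto_sum_twinTerm_sub] with ω ⟨l, hl⟩ ⟨l', hl'⟩
  exact tendsto_piHat_mul_log_div (h.mem_ge_two ω) hl hl'
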